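/- arXiv:1403.1567 — 7 statements merged into one kernel-verified Lean document; each statement's English description precedes it below -/
import Mathlib

section
/- Let n ≥ 1 and let M be an n × n real symmetric matrix with nonnegative diagonal entries that is diagonally dominant, i.e. M i i ≥ ∑_{j ≠ i} |M i j| for every i. Suppose M is not block-diagonal, i.e. for every subset S of indices with ∅ ⊊ S ⊊ {1,…,n} there exist i ∈ S and j ∉ S with M i j ≠ 0. If there exists some index i with M i i > ∑_{j ≠ i} |M i j| (strict inequality), then M is nonsingular (det M ≠ 0). -/
/-- If `M v = 0`, the deviations of `|v j|` from `|v i|`, weighted by the off-diagonal entries of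
row `i`, are controlled by the dominance gap of that row. -/
theorem Matrix.sum_abs_mul_sub_le_of_mulVec_eq_zero {ι : Type*} [Fintype ι] [DecidableEq ι]
    {M : Matrix ι ι ℝ} {v : ι → ℝ} (hv : M.mulVec v = 0) (i : ι) :
    ∑ j ∈ Finset.univ.erase i, |M i j| * (|v i| - |v j|) ≤
      (∑ j ∈ Finset.univ.erase i, |M i j| - M i i) * |v i| := by
  have hrow : ∑ j, M i j * v j = 0 := congrFun hv i
  rw [← Finset.add_sum_erase _ _ (Finset.mem_univ i)] at hrow
  have hle : M i i * |v i| ≤ ∑ j ∈ Finset.univ.erase i, |M i j| * |v j| :=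
    calc M i i * |v i| ≤ |M i i| * |v i| := by gcongr; exact le_abs_self _
      _ = |∑ j ∈ Finset.univ.erase i, M i j * v j| := by
        rw [← abs_mul, eq_neg_of_add_eq_zero_left hrow, abs_neg]
      _ ≤ ∑ j ∈ Finset.univ.erase i, |M i j * v j| := Finset.abs_sum_le_sum_abs _ _
      _ = ∑ j ∈ Finset.univ.erase i, |M i j| * |v j| := by simp only [abs_mul]
  simp only [mul_sub, Finset.sum_sub_distrib, ← Finset.sum_mul, sub_mul]
  linarith

/-- A diagonally-dominant real symmetric matrix with nonnegative diagonal entries which is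
not block-diagonal and has at least one row with strict diagonal dominance is nonsingular. -/
theorem strict_row_dominance_nonsingular_real
    (n : ℕ) (hn : 1 ≤ n) (M : Matrix (Fin n) (Fin n) ℝ)
    (hsym : M.IsSymm) (hdiag : ∀ i, 0 ≤ M i i)
    (hdd : ∀ i, ∑ j ∈ Finset.univ.erase i, |M i j| ≤ M i i)
    (hblock : ∀ S : Finset (Fin n), S.Nonempty → S ≠ Finset.univ →
      ∃ i ∈ S, ∃ j ∉ S, M i j ≠ 0)
    (hstrict : ∃ i, ∑ j ∈ Finset.univ.erase i, |M i j| < M i i) :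
    M.det ≠ 0 := by
  intro hdet
  obtain ⟨v, hv, hMv⟩ := Matrix.exists_mulVec_eq_zero_iff.mpr hdet
  obtain ⟨l, hl⟩ := Function.ne_iff.mp hv
  obtain ⟨k, -, hk⟩ := Finset.exists_max_image Finset.univ (fun i => |v i|) ⟨l, Finset.mem_univ l⟩
  have hmax (j) : |v j| ≤ |v k| := hk j (Finset.mem_univ j)
  have hpos : 0 < |v k| := (abs_pos.mpr hl).trans_le (hmax l)
  have hnonneg (i) (hi : |v i| = |v k|) (j) : 0 ≤ |M i j| * (|v i| - |v j|) :=
    mul_nonneg (abs_nonneg _) (by linarith [hmax j])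
  by_cases hS : Finset.univ.filter (fun i => |v i| = |v k|) = Finset.univ
  · obtain ⟨i, hi⟩ := hstrict
    have hik : |v i| = |v k| := Finset.filter_eq_self.mp hS i (Finset.mem_univ i)
    have hsum := Matrix.sum_abs_mul_sub_le_of_mulVec_eq_zero hMv i
    have hneg := mul_neg_of_neg_of_pos (sub_neg.mpr hi) (hik ▸ hpos)
    exact absurd (Finset.sum_nonneg fun j _ => hnonneg i hik j) (hsum.trans_lt hneg).not_ge
  · obtain ⟨i, hi, j, hj, hij⟩ := hblock _ ⟨k, by simp⟩ hS
    have hji : j ≠ i := fun h => hj (h ▸ hi)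
    have hik : |v i| = |v k| := by simpa using hi
    have hjk : |v j| < |v k| := (hmax j).lt_of_ne (by simpa using hj)
    have hsum := Matrix.sum_abs_mul_sub_le_of_mulVec_eq_zero hMv i
    have hnonpos := mul_nonpos_of_nonpos_of_nonneg (sub_nonpos.mpr (hdd i)) (abs_nonneg (v i))
    have hterm : 0 < |M i j| * (|v i| - |v j|) :=
      mul_pos (abs_pos.mpr hij) (by linarith)
    exact absurd (Finset.sum_pos' (fun j _ => hnonneg i hik j) ⟨j, by simpa using hji, hterm⟩)
      (hsum.trans hnonpos).not_gt
end

section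
/- Let D and A be n × n matrices over a commutative ring, with D diagonal (D i j = 0 for i ≠ j). Then det(D + A) = ∑_{S ⊆ {1,…,n}} (∏_{i ∈ S} D i i) · det(A restricted to rows and columns indexed by the complement of S), where for S equal to the full index set the empty determinant is interpreted as 1. -/
/-- Replacing the rows of `A` indexed by `S` with the corresponding rows of a diagonal matrix
multiplies the principal minor of `A` on the complement of `S` by the diagonal entries over `S`. -/
theorem det_piecewise_diagonal {m R : Type*} [Fintype m] [DecidableEq m] [CommRing R]
    (d : m → R) (A : Matrix m m R) (S : Finset m) :
    (Matrix.of (S.piecewise (Matrix.diagonal d).row A.row)).det =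
      (∏ i ∈ S, d i) * (A.submatrix (fun i : {j // j ∈ Sᶜ} => (i : m))
        (fun j : {j // j ∈ Sᶜ} => (j : m))).det := by
  let M : Matrix m m R := Matrix.of (Sᶜ.piecewise A.row (1 : Matrix m m R).row)
  have hM : Matrix.of (S.piecewise (Matrix.diagonal d).row A.row) =
      S.piecewise (fun i => d i • M i) M := by
    ext i j
    by_cases hi : i ∈ S <;>
      simp [M, Finset.piecewise, hi, Matrix.diagonal_apply, Matrix.one_apply]
  rw [← Matrix.det_piecewise_one_eq_submatrix_det A Sᶜ, hM]
  exact Matrix.detRowAlternating.toMultilinearMap.map_piecewise_smul d M S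

/-- Determinant expansion of `D + A` for a diagonal matrix `D`: sum over subsets `S` of the
index set of the product of the diagonal entries of `D` over `S` times the principal minor
of `A` on the complement of `S`. -/
theorem det_diagonal_add_expansion
    (n : ℕ) (R : Type*) [CommRing R] (D A : Matrix (Fin n) (Fin n) R)
    (hD : ∀ i j, i ≠ j → D i j = 0) :
    (D + A).det = ∑ S : Finset (Fin n),
      (∏ i ∈ S, D i i) *
        (A.submatrix (fun i : {j // j ∈ Sᶜ} => (i : Fin n))
          (fun j : {j // j ∈ Sᶜ} => (j : Fin n))).det := by
  have h : Matrix.diagonal D.diag = D :=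
    (Matrix.isDiag_iff_diagonal_diag D).mp fun i j hij => hD i j hij
  refine (Matrix.detRowAlternating.toMultilinearMap.map_add_univ D A).trans
    (Finset.sum_congr rfl fun S _ => ?_)
  have hS := det_piecewise_diagonal D.diag A S
  rw [h] at hS
  exact hS
end

section
/- Let n ≥ 1 and let M be an n × n real symmetric matrix with M i i = ∑_{j ≠ i} |M i j| for every i (equality of diagonal dominance in every row). Suppose M is not block-diagonal, i.e. for every subset S with ∅ ⊊ S ⊊ {1,…,n} there exist i ∈ S and j ∉ S with M i j ≠ 0. Then M is singular (det M = 0) if and only if there exists a function ε : {1,…,n} → {−1, +1} such that M i j = −|M i j| · ε_i ε_j for all i ≠ j. -/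
/-- If the diagonal entries of `M` are the absolute off-diagonal row sums, then `M *ᵥ v` is a sum
over off-diagonal entries only. -/
theorem mulVec_eq_sum_erase_of_diag_eq {ι : Type*} [Fintype ι] [DecidableEq ι]
    {M : Matrix ι ι ℝ} (hdd : ∀ i, M i i = ∑ j ∈ Finset.univ.erase i, |M i j|)
    (v : ι → ℝ) (i : ι) :
    M.mulVec v i = ∑ j ∈ Finset.univ.erase i, (|M i j| * v i + M i j * v j) := by
  rw [Finset.sum_add_distrib, ← Finset.sum_mul, ← hdd i]
  exact (Finset.add_sum_erase _ (fun j => M i j * v j) (Finset.mem_univ i)).symm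

/-- Maximum principle: at an index where `|v|` is maximal and `M *ᵥ v` vanishes, every
off-diagonal contribution vanishes. -/
theorem abs_mul_sq_add_eq_zero_of_mulVec_eq_zero {ι : Type*} [Fintype ι] [DecidableEq ι]
    {M : Matrix ι ι ℝ} (hdd : ∀ i, M i i = ∑ j ∈ Finset.univ.erase i, |M i j|)
    {v : ι → ℝ} {i : ι} (hv : M.mulVec v i = 0) (hmax : ∀ j, |v j| ≤ |v i|)
    {j : ι} (hij : i ≠ j) :
    |M i j| * v i ^ 2 + M i j * v i * v j = 0 := by
  have hsum : ∑ j ∈ Finset.univ.erase i, (|M i j| * v i ^ 2 + M i j * v i * v j) = 0 := by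
    rw [mulVec_eq_sum_erase_of_diag_eq hdd] at hv
    rw [← mul_zero (v i), ← hv, Finset.mul_sum]
    exact Finset.sum_congr rfl fun j _ => by ring
  refine (Finset.sum_eq_zero_iff_of_nonneg fun j _ => ?_).mp hsum j
    (Finset.mem_erase.mpr ⟨hij.symm, Finset.mem_univ j⟩)
  have hle : |M i j * v i * v j| ≤ |M i j| * v i ^ 2 := by
    rw [abs_mul, abs_mul, ← sq_abs (v i), sq, ← mul_assoc]
    exact mul_le_mul_of_nonneg_left (hmax j) (by positivity)
  linarith [neg_abs_le (M i j * v i * v j)]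


/-- A real symmetric matrix whose every diagonal entry equals the sum of the absolute values
of the other entries of its row, and which is not block-diagonal, is singular if and only if
the associated sign connection is gauge-equivalent to the trivial one, i.e. there are signs
`ε i ∈ {-1, +1}` with `M i j = -|M i j| * ε i * ε j` for all `i ≠ j`. -/
theorem laplacian_singular_iff_trivial_gauge_real
    (n : ℕ) (hn : 1 ≤ n) (M : Matrix (Fin n) (Fin n) ℝ)
    (hsym : M.IsSymm)
    (hdd : ∀ i, M i i = ∑ j ∈ Finset.univ.erase i, |M i j|)
    (hblock : ∀ S : Finset (Fin n), S.Nonempty → S ≠ Finset.univ →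
      ∃ i ∈ S, ∃ j ∉ S, M i j ≠ 0) :
    M.det = 0 ↔
      ∃ ε : Fin n → ℝ, (∀ i, ε i = 1 ∨ ε i = -1) ∧
        ∀ i j, i ≠ j → M i j = -|M i j| * ε i * ε j := by
  have : NeZero n := ⟨by omega⟩
  rw [← Matrix.exists_mulVec_eq_zero_iff]
  constructor
  · rintro ⟨v, hv, hMv⟩
    obtain ⟨k, hk⟩ := Finite.exists_max fun i => |v i|
    have hpos : 0 < |v k| := by
      obtain ⟨i, hi⟩ := Function.ne_iff.mp hv
      exact (abs_pos.mpr hi).trans_le (hk i)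
    have hterm (i : Fin n) (hi : |v i| = |v k|) (j : Fin n) (hij : i ≠ j) :=
      abs_mul_sq_add_eq_zero_of_mulVec_eq_zero hdd (congrFun hMv i)
        (fun j => (hk j).trans_eq hi.symm) hij
    have hall : ∀ i, |v i| = |v k| := by
      by_contra! ⟨l, hl⟩
      obtain ⟨i, hi, j, hj, hij⟩ :=
        hblock (Finset.univ.filter fun i => |v i| = |v k|) ⟨k, by simp⟩ fun h => hl <| by
          simpa using Finset.ext_iff.mp h l
      simp only [Finset.mem_filter, Finset.mem_univ, true_and] at hi hj
      have hne : i ≠ j := fun h => hj (h ▸ hi)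
      have habs : |M i j| * (|v i| * |v i|) = |M i j| * (|v i| * |v j|) := by
        have h := congrArg abs (eq_neg_of_add_eq_zero_left (hterm i hi j hne))
        simp only [abs_neg, abs_mul, abs_abs, abs_pow] at h
        linear_combination h
      have hi0 : |v i| ≠ 0 := hi ▸ hpos.ne'
      exact hj ((mul_left_cancel₀ hi0 (mul_left_cancel₀ (abs_ne_zero.mpr hij) habs)).symm.trans hi)
    refine ⟨fun i => v i / |v k|, fun i => ?_, fun i j hij => ?_⟩
    · rcases eq_or_eq_neg_of_abs_eq (hall i) with h | h
      · left; simp only [h, div_self hpos.ne']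
      · right; simp only [h, neg_div, div_self hpos.ne']
    · have hsq (i : Fin n) : v i ^ 2 = |v k| ^ 2 := by rw [← hall i, sq_abs]
      have h := hterm i (hall i) j hij
      have hi0 : v i ≠ 0 := abs_pos.mp (hall i ▸ hpos)
      have hcancel : |M i j| * v i + M i j * v j = 0 := by
        apply mul_left_cancel₀ hi0
        linear_combination h
      field_simp
      linear_combination v j * hcancel - M i j * hsq j
  · rintro ⟨ε, hε, hM⟩
    refine ⟨ε, fun h => ?_, ?_⟩
    · have h0 := congrFun h 0
      rcases hε 0 with h1 | h1 <;> simp [h1] at h0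
    · ext i
      rw [mulVec_eq_sum_erase_of_diag_eq hdd, Pi.zero_apply]
      refine Finset.sum_eq_zero fun j hj => ?_
      rw [hM i j (Finset.ne_of_mem_erase hj).symm, abs_mul, abs_mul, abs_neg, abs_abs]
      rcases hε i with hi | hi <;> rcases hε j with hj | hj <;> simp [hi, hj]
end

section
/- Let n ≥ 2. Among the 2^{n(n−1)/2} real symmetric n × n matrices B with zero diagonal and all strict upper-diagonal entries in {−1, +1}, the number of B for which the matrix I_n + B/(n−1) is singular is exactly 2^{n−1}. Equivalently, if B is chosen uniformly at random from this set, the probability that I_n + B/(n−1) is singular equals 2^{−(n−1)(n−2)/2}. -/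
/-- The matrix `B` is symmetric with zero diagonal and off-diagonal entries `±1`. -/
def IsSignSeidel {ι : Type*} (B : Matrix ι ι ℝ) : Prop :=
  B.IsSymm ∧ (∀ i, B i i = 0) ∧ ∀ i j, i ≠ j → B i j = 1 ∨ B i j = -1

/-- The sign `±1` of a Boolean. -/
def boolSign (b : Bool) : ℝ := if b then 1 else -1

theorem boolSign_eq (b : Bool) : boolSign b = 1 ∨ boolSign b = -1 := by
  cases b <;> simp [boolSign]

theorem boolSign_injective : Function.Injective boolSign := by
  intro a b h
  cases a <;> cases b <;> simp [boolSign] at h ⊢ <;> norm_num at h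

theorem exists_boolSign {r : ℝ} (h : r = 1 ∨ r = -1) : ∃ b, boolSign b = r := by
  rcases h with rfl | rfl
  · exact ⟨true, rfl⟩
  · exact ⟨false, rfl⟩

theorem ncard_isSignSeidel (n : ℕ) :
    Set.ncard {B : Matrix (Fin n) (Fin n) ℝ | IsSignSeidel B} = 2 ^ (n * (n - 1) / 2) := by
  classical
  let F : ({a : Sym2 (Fin n) // ¬ a.IsDiag} → Bool) → Matrix (Fin n) (Fin n) ℝ :=
    fun f i j => if h : i = j then 0 else boolSign (f ⟨s(i, j), by simpa using h⟩)
  have hF : Function.Injective F := by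
    intro f g h
    funext ⟨a, ha⟩
    induction a using Sym2.ind with
    | _ i j =>
      have hij : i ≠ j := by simpa using ha
      have := congrFun (congrFun h i) j
      simp only [F, dif_neg hij] at this
      exact boolSign_injective this
  have hrange : {B : Matrix (Fin n) (Fin n) ℝ | IsSignSeidel B} = Set.range F := by
    ext B
    constructor
    · rintro ⟨hs, hd, ho⟩
      have key : ∀ a : {a : Sym2 (Fin n) // ¬ a.IsDiag}, ∃ b : Bool,
          ∀ i j, s(i, j) = a.1 → boolSign b = B i j := by
        rintro ⟨a, ha⟩
        induction a using Sym2.ind with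
        | _ i j =>
          obtain ⟨b, hb⟩ := exists_boolSign (ho i j (by simpa using ha))
          refine ⟨b, fun k l hkl => ?_⟩
          rcases Sym2.eq_iff.1 hkl with ⟨rfl, rfl⟩ | ⟨rfl, rfl⟩
          · exact hb
          · rw [hb, hs.apply]
      choose f hf using key
      refine ⟨f, ?_⟩
      ext i j
      by_cases hij : i = j
      · subst hij; simp [F, hd]
      · simp only [F, dif_neg hij]
        exact hf _ _ _ rfl
    · rintro ⟨f, rfl⟩
      refine ⟨?_, fun i => by simp [F], fun i j hij => ?_⟩
      · ext i j
        rw [Matrix.transpose_apply]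
        by_cases hij : i = j
        · rw [hij]
        · simp only [F, dif_neg hij, dif_neg (Ne.symm hij), Sym2.eq_swap (a := j) (b := i)]
      · simp only [F, dif_neg hij]
        exact boolSign_eq _
  rw [hrange, Set.ncard_range_of_injective hF, Nat.card_eq_fintype_card, Fintype.card_fun,
    Fintype.card_bool, Sym2.card_subtype_not_diag, Fintype.card_fin, Nat.choose_two_right]

/-- In the kernel equation, a coordinate of maximal modulus forces equality in the triangle
inequality. -/
theorem IsSignSeidel.eq_neg_mul_of_abs_le {n : ℕ} {B : Matrix (Fin n) (Fin n) ℝ}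
    (hB : IsSignSeidel B) {x : Fin n → ℝ} {i : Fin n}
    (hx : ((n : ℝ) - 1) * x i + ∑ j, B i j * x j = 0) (hmax : ∀ j, |x j| ≤ |x i|)
    (hi : x i ≠ 0) {j : Fin n} (hij : i ≠ j) : x i = -(B i j * x j) := by
  have hsum : ∑ j ∈ Finset.univ.erase i, x i * (x i + B i j * x j) = 0 := by
    rw [← Finset.mul_sum, Finset.sum_add_distrib, Finset.sum_const,
      Finset.card_erase_of_mem (Finset.mem_univ i), Finset.card_univ, Fintype.card_fin,
      nsmul_eq_mul, Nat.cast_pred i.pos, Finset.sum_erase _ (by rw [hB.2.1, zero_mul]), hx,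
      mul_zero]
  have hnonneg : ∀ j ∈ Finset.univ.erase i, 0 ≤ x i * (x i + B i j * x j) := by
    intro j hj
    have h1 : |x i * x j| ≤ x i * x i := by
      rw [abs_mul, ← abs_mul_abs_self (x i)]
      exact mul_le_mul_of_nonneg_left (hmax j) (abs_nonneg _)
    have h2 := abs_le.1 h1
    rcases hB.2.2 i j (Finset.ne_of_mem_erase hj).symm with h | h <;> rw [h] <;> linarith
  have h := (Finset.sum_eq_zero_iff_of_nonneg hnonneg).1 hsum j
    (Finset.mem_erase.2 ⟨hij.symm, Finset.mem_univ j⟩)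
  linarith [(mul_eq_zero.1 h).resolve_left hi]

theorem one_add_inv_smul_mulVec_eq_zero_iff {n : ℕ} (hn : 2 ≤ n)
    (B : Matrix (Fin n) (Fin n) ℝ) (x : Fin n → ℝ) :
    (1 + ((n : ℝ) - 1)⁻¹ • B).mulVec x = 0 ↔
      ∀ i, ((n : ℝ) - 1) * x i + ∑ j, B i j * x j = 0 := by
  have hn' : (n : ℝ) - 1 ≠ 0 := by
    have : (2 : ℝ) ≤ n := by exact_mod_cast hn
    linarith
  rw [funext_iff]
  refine forall_congr' fun i => ?_
  rw [Matrix.add_mulVec, Matrix.one_mulVec, Matrix.smul_mulVec, Pi.add_apply, Pi.smul_apply,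
    Pi.zero_apply, smul_eq_mul, Matrix.mulVec, dotProduct, ← mul_right_inj' hn', mul_add,
    mul_inv_cancel_left₀ hn', mul_zero]

theorem IsSignSeidel.exists_eq_neg_mul_of_det_eq_zero {n : ℕ} (hn : 2 ≤ n)
    {B : Matrix (Fin n) (Fin n) ℝ} (hB : IsSignSeidel B)
    (hdet : (1 + ((n : ℝ) - 1)⁻¹ • B).det = 0) :
    ∃ x : Fin n → ℝ, (∀ i, x i ≠ 0) ∧ ∀ i j, i ≠ j → x i = -(B i j * x j) := by
  obtain ⟨x, hx0, hx⟩ := Matrix.exists_mulVec_eq_zero_iff.2 hdet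
  rw [one_add_inv_smul_mulVec_eq_zero_iff hn] at hx
  have : Nonempty (Fin n) := ⟨⟨0, by omega⟩⟩
  obtain ⟨i, hi⟩ := Finite.exists_max fun i => |x i|
  obtain ⟨k, hk⟩ := Function.ne_iff.1 hx0
  have hi0 : x i ≠ 0 := abs_pos.1 ((abs_pos.2 hk).trans_le (hi k))
  have habs : ∀ j, |x j| = |x i| := by
    intro j
    by_cases hij : i = j
    · rw [hij]
    · rw [hB.eq_neg_mul_of_abs_le (hx i) hi hi0 hij]
      rcases hB.2.2 i j hij with h | h <;> simp [h]
  have hne : ∀ j, x j ≠ 0 := fun j => by rw [← abs_pos, habs, abs_pos]; exact hi0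
  exact ⟨x, hne, fun j l hjl =>
    hB.eq_neg_mul_of_abs_le (hx j) (fun m => by rw [habs, habs j]) (hne j) hjl⟩

theorem det_one_add_inv_smul_eq_zero {n : ℕ} (hn : 2 ≤ n) {s : Fin n → ℝ}
    (hs : ∀ i, s i * s i = 1) :
    (1 + ((n : ℝ) - 1)⁻¹ •
      (Matrix.of fun i j => if i = j then 0 else -(s i * s j) : Matrix _ _ ℝ)).det = 0 := by
  refine Matrix.exists_mulVec_eq_zero_iff.1 ⟨s, fun h => ?_, ?_⟩
  · simpa [h] using hs ⟨0, by omega⟩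
  · rw [one_add_inv_smul_mulVec_eq_zero_iff hn]
    intro i
    have h : ∀ j, (Matrix.of fun i j => if i = j then 0 else -(s i * s j) : Matrix _ _ ℝ) i j * s j
        = (if i = j then s i else 0) - s i := by
      intro j
      by_cases hij : i = j
      · simp [hij]
      · simp [hij, mul_assoc, hs]
    simp only [h, Finset.sum_sub_distrib, Finset.sum_ite_eq, Finset.mem_univ, if_true,
      Finset.sum_const, Finset.card_univ, Fintype.card_fin, nsmul_eq_mul]
    ring

theorem ncard_isSignSeidel_det_eq_zero {n : ℕ} (hn : 2 ≤ n) :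
    Set.ncard {B : Matrix (Fin n) (Fin n) ℝ | IsSignSeidel B ∧
      (1 + ((n : ℝ) - 1)⁻¹ • B).det = 0} = 2 ^ (n - 1) := by
  obtain ⟨m, rfl⟩ : ∃ m, n = m + 1 := ⟨n - 1, by omega⟩
  let s : (Fin m → Bool) → Fin (m + 1) → ℝ := fun f => Fin.cons 1 fun i => boolSign (f i)
  have hs : ∀ f i, s f i = 1 ∨ s f i = -1 := by
    intro f i
    cases i using Fin.cases with
    | zero => exact Or.inl rfl
    | succ i => exact boolSign_eq _
  let F : (Fin m → Bool) → Matrix (Fin (m + 1)) (Fin (m + 1)) ℝ :=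
    fun f => Matrix.of fun i j => if i = j then 0 else -(s f i * s f j)
  have hF0 : ∀ f i, F f 0 (Fin.succ i) = -boolSign (f i) := by
    intro f i
    simp [F, s, (Fin.succ_ne_zero i).symm]
  have hF : Function.Injective F := by
    intro f g h
    funext i
    have := congrFun (congrFun h 0) i.succ
    rw [hF0, hF0, neg_inj] at this
    exact boolSign_injective this
  have hrange : {B : Matrix (Fin (m + 1)) (Fin (m + 1)) ℝ | IsSignSeidel B ∧
      (1 + (((m + 1 : ℕ) : ℝ) - 1)⁻¹ • B).det = 0} = Set.range F := by
    ext B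
    constructor
    · rintro ⟨hB, hdet⟩
      obtain ⟨x, hx0, hx⟩ := hB.exists_eq_neg_mul_of_det_eq_zero hn hdet
      have key : ∀ i : Fin m, ∃ b, boolSign b = -B 0 i.succ := fun i =>
        exists_boolSign (by
          rcases hB.2.2 0 i.succ (Fin.succ_ne_zero i).symm with h | h <;> simp [h])
      choose f hf using key
      have hsx : ∀ i, x i = s f i * x 0 := by
        intro i
        cases i using Fin.cases with
        | zero => simp [s]
        | succ i =>
          simp only [s, Fin.cons_succ, hf]
          rw [hx _ _ (Fin.succ_ne_zero i), hB.1.apply]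
          ring
      refine ⟨f, ?_⟩
      ext i j
      by_cases hij : i = j
      · simp [F, hij, hB.2.1]
      · simp only [F, Matrix.of_apply, if_neg hij]
        have h := hx i j hij
        rw [hsx i, hsx j] at h
        have h' : s f i = -(B i j * s f j) := mul_right_cancel₀ (hx0 0) (by linarith)
        rw [h']
        rcases hs f j with h | h <;> rw [h] <;> ring
    · rintro ⟨f, rfl⟩
      refine ⟨⟨?_, fun i => by simp [F], fun i j hij => ?_⟩,
        det_one_add_inv_smul_eq_zero hn fun i => ?_⟩
      · ext i j
        simp only [Matrix.transpose_apply, F, Matrix.of_apply, eq_comm (a := j), mul_comm (s f j)]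
      · simp only [F, Matrix.of_apply, if_neg hij]
        rcases hs f i with h | h <;> rcases hs f j with h' | h' <;> simp [h, h']
      · rcases hs f i with h | h <;> simp [h]
  rw [hrange, Set.ncard_range_of_injective hF, Nat.card_eq_fintype_card, Fintype.card_fun,
    Fintype.card_bool, Fintype.card_fin, Nat.add_sub_cancel]

/-- Among the `2 ^ (n*(n-1)/2)` real symmetric `n × n` matrices `B` with zero diagonal and
`±1` strict off-diagonal entries, exactly `2 ^ (n-1)` are such that `I + B/(n-1)` is
singular; hence the probability of singularity under the uniform measure is
`2 ^ (-(n-1)*(n-2)/2)`. -/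
theorem count_singular_perturbed_identity_real
    (n : ℕ) (hn : 2 ≤ n) :
    Set.ncard {B : Matrix (Fin n) (Fin n) ℝ | B.IsSymm ∧ (∀ i, B i i = 0) ∧
        ∀ i j, i ≠ j → B i j = 1 ∨ B i j = -1} = 2 ^ (n * (n - 1) / 2) ∧
    Set.ncard {B : Matrix (Fin n) (Fin n) ℝ | (B.IsSymm ∧ (∀ i, B i i = 0) ∧
        ∀ i j, i ≠ j → B i j = 1 ∨ B i j = -1) ∧
        (1 + ((n : ℝ) - 1)⁻¹ • B).det = 0} = 2 ^ (n - 1) := by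
  exact ⟨ncard_isSignSeidel n, ncard_isSignSeidel_det_eq_zero hn⟩
end

section
/- Let n ≥ 1. Among the 2^{n(n+1)/2} real symmetric n × n matrices Q with all entries (diagonal and off-diagonal) in {−1, +1}, the number of Q having n as an eigenvalue is exactly 2^{n−1}. Equivalently, if Q is chosen uniformly at random from this set, the probability that n is an eigenvalue of Q equals 2^{−(n²−n+2)/2}. -/
/-- The number of symmetric sign matrices, one sign for each unordered pair of indices. -/
theorem ncard_isSymm_sign_matrices (ι : Type*) [Fintype ι] [DecidableEq ι] :
    Set.ncard {Q : Matrix ι ι ℝ | Q.IsSymm ∧ ∀ i j, Q i j = 1 ∨ Q i j = -1} =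
      2 ^ (Fintype.card ι * (Fintype.card ι + 1) / 2) := by
  let f : (Sym2 ι → ℤˣ) → Matrix ι ι ℝ := fun s => Matrix.of fun i j => ((s s(i, j) : ℤ) : ℝ)
  have hf : Function.Injective f := by
    intro s t h
    funext p
    induction p with
    | _ i j => exact Units.ext (Int.cast_injective (congrFun (congrFun h i) j))
  have hrange : {Q : Matrix ι ι ℝ | Q.IsSymm ∧ ∀ i j, Q i j = 1 ∨ Q i j = -1} =
      f '' Set.univ := by
    ext Q
    simp only [Set.mem_ofPred_eq, Set.image_univ, Set.mem_range]
    constructor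
    · rintro ⟨hsymm, hsign⟩
      refine ⟨Sym2.lift ⟨fun i j => if Q i j = 1 then 1 else -1, fun i j => ?_⟩, ?_⟩
      · simp only [hsymm.apply i j]
      · ext i j
        rcases hsign i j with h | h <;> norm_num [f, h]
    · rintro ⟨s, rfl⟩
      refine ⟨Matrix.IsSymm.ext fun i j => ?_, fun i j => ?_⟩
      · simp only [f, Matrix.of_apply, Sym2.eq_swap]
      · rcases Int.units_eq_one_or (s s(i, j)) with h | h <;> simp [f, h]
  rw [hrange, Set.ncard_image_of_injective _ hf, Set.ncard_univ, Nat.card_eq_fintype_card,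
    Fintype.card_fun, Sym2.card, Fintype.card_units_int, Nat.choose_two_right,
    Nat.add_sub_cancel, mul_comm]

/-- An eigenvector of a sign matrix for the largest conceivable eigenvalue turns every row
into a sum of equal terms. -/
theorem mul_apply_eq_of_mulVec_eq_card_smul {ι : Type*} [Fintype ι] {Q : Matrix ι ι ℝ}
    (hQ : ∀ i j, Q i j = 1 ∨ Q i j = -1) {v : ι → ℝ}
    (hv : Q.mulVec v = (Fintype.card ι : ℝ) • v) (i j : ι) : Q i j * v j = v i := by
  have habs : ∀ i j, |Q i j * v j| = |v j| := by
    intro i j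
    rcases hQ i j with h | h <;> simp [h]
  have hrow : ∀ i, ∑ j, Q i j * v j = ∑ _j : ι, v i := by
    intro i
    simpa [Matrix.mulVec, dotProduct] using congrFun hv i
  have heq : ∀ i, (∀ j, |v j| ≤ |v i|) → ∀ j, Q i j * v j = v i := by
    intro i hmax j
    rcases le_total 0 (v i) with hi | hi
    · refine (Finset.sum_eq_sum_iff_of_le fun k _ => ?_).1 (hrow i) j (Finset.mem_univ j)
      exact (le_abs_self _).trans (by rw [habs]; exact (hmax k).trans_eq (abs_of_nonneg hi))
    · refine ((Finset.sum_eq_sum_iff_of_le fun k _ => ?_).1 (hrow i).symm j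
        (Finset.mem_univ j)).symm
      have := hmax k
      rw [← habs i, abs_of_nonpos hi] at this
      linarith [neg_abs_le (Q i k * v k)]
  have : Nonempty ι := ⟨i⟩
  obtain ⟨m, hm⟩ := Finite.exists_max fun k => |v k|
  have hconst : ∀ k, |v k| = |v m| := fun k => by rw [← habs m k, heq m hm k]
  exact heq i (fun k => by rw [hconst k, hconst i]) j

/-- A symmetric sign matrix whose size is an eigenvalue has rank one. -/
theorem apply_eq_mul_of_det_eq_zero {ι : Type*} [Fintype ι] [DecidableEq ι]
    {Q : Matrix ι ι ℝ} (hsymm : Q.IsSymm) (hQ : ∀ i j, Q i j = 1 ∨ Q i j = -1)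
    (hdet : ((Fintype.card ι : ℝ) • (1 : Matrix ι ι ℝ) - Q).det = 0) (i j k : ι) :
    Q i j = Q k i * Q k j := by
  obtain ⟨v, hv0, hv⟩ := Matrix.exists_mulVec_eq_zero_iff.2 hdet
  have hrow := mul_apply_eq_of_mulVec_eq_card_smul hQ (v := v) (by
    rw [Matrix.sub_mulVec, Matrix.smul_mulVec, Matrix.one_mulVec, sub_eq_zero] at hv
    exact hv.symm)
  have hvj : v j ≠ 0 := fun h => hv0 (funext fun l => by simpa [h] using (hrow l j).symm)
  refine mul_right_cancel₀ hvj ?_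
  rw [mul_assoc, hrow k j, ← hsymm.apply k i, hrow i k, hrow i j]

/-- The sign matrices of size `m + 1` having `m + 1` as an eigenvalue correspond to the sign
vectors whose first entry is `1`. -/
theorem ncard_isSymm_sign_matrices_det_eq_zero (m : ℕ) :
    Set.ncard {Q : Matrix (Fin (m + 1)) (Fin (m + 1)) ℝ | (Q.IsSymm ∧
        ∀ i j, Q i j = 1 ∨ Q i j = -1) ∧
        (((m + 1 : ℕ) : ℝ) • (1 : Matrix (Fin (m + 1)) (Fin (m + 1)) ℝ) - Q).det = 0} =
      2 ^ m := by
  let w : (Fin m → ℤˣ) → Fin (m + 1) → ℤˣ := fun s => Fin.cons 1 s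
  let f : (Fin m → ℤˣ) → Matrix (Fin (m + 1)) (Fin (m + 1)) ℝ :=
    fun s => Matrix.of fun i j => ((w s i * w s j : ℤˣ) : ℤ)
  have hf : Function.Injective f := by
    intro s t h
    funext i
    have := Units.ext (Int.cast_injective (congrFun (congrFun h 0) i.succ))
    simpa [w] using this
  have hrange : {Q : Matrix (Fin (m + 1)) (Fin (m + 1)) ℝ | (Q.IsSymm ∧
        ∀ i j, Q i j = 1 ∨ Q i j = -1) ∧
        (((m + 1 : ℕ) : ℝ) • (1 : Matrix (Fin (m + 1)) (Fin (m + 1)) ℝ) - Q).det = 0} =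
      f '' Set.univ := by
    ext Q
    simp only [Set.mem_ofPred_eq, Set.image_univ, Set.mem_range]
    constructor
    · rintro ⟨⟨hsymm, hsign⟩, hdet⟩
      have hmul := apply_eq_mul_of_det_eq_zero hsymm hsign (by simpa using hdet)
      let s : Fin m → ℤˣ := fun i => if Q 0 i.succ = 1 then 1 else -1
      have hw : ∀ i, (((w s i : ℤˣ) : ℤ) : ℝ) = Q 0 i := by
        intro i
        cases i using Fin.cases with
        | zero =>
          have := hmul 0 0 0
          rcases hsign 0 0 with h | h
          · simp [w, h]
          · norm_num [h] at this
        | succ i => rcases hsign 0 i.succ with h | h <;> norm_num [w, s, h]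
      refine ⟨s, ?_⟩
      ext i j
      rw [hmul i j 0, ← hw i, ← hw j]
      simp [f]
    · rintro ⟨s, rfl⟩
      refine ⟨⟨Matrix.IsSymm.ext fun i j => ?_, fun i j => ?_⟩, ?_⟩
      · simp only [f, Matrix.of_apply, mul_comm]
      · rcases Int.units_eq_one_or (w s i * w s j) with h | h <;>
          simp only [f, Matrix.of_apply, h] <;> simp
      · refine Matrix.exists_mulVec_eq_zero_iff.1 ⟨fun i => ((w s i : ℤ) : ℝ), ?_, ?_⟩
        · exact fun h => by simpa [w] using congrFun h 0
        · have hsq : ∀ j, ((w s j : ℤ) : ℝ) * ((w s j : ℤ) : ℝ) = 1 := fun j => by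
            rcases Int.units_eq_one_or (w s j) with h | h <;> simp [h]
          rw [Matrix.sub_mulVec, Matrix.smul_mulVec, Matrix.one_mulVec, sub_eq_zero]
          ext i
          simp [f, Matrix.mulVec, dotProduct, mul_assoc, hsq]
  rw [hrange, Set.ncard_image_of_injective _ hf, Set.ncard_univ, Nat.card_eq_fintype_card,
    Fintype.card_fun, Fintype.card_units_int, Fintype.card_fin]

/-- Among the `2 ^ (n*(n+1)/2)` real symmetric `n × n` matrices `Q` with all entries in
`{-1, +1}`, exactly `2 ^ (n-1)` have `n` as an eigenvalue; hence the probability of this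
event under the uniform measure is `2 ^ (-(n^2-n+2)/2)`. -/
theorem count_eigenvalue_n_bernoulli_real
    (n : ℕ) (hn : 1 ≤ n) :
    Set.ncard {Q : Matrix (Fin n) (Fin n) ℝ | Q.IsSymm ∧
        ∀ i j, Q i j = 1 ∨ Q i j = -1} = 2 ^ (n * (n + 1) / 2) ∧
    Set.ncard {Q : Matrix (Fin n) (Fin n) ℝ | (Q.IsSymm ∧
        ∀ i j, Q i j = 1 ∨ Q i j = -1) ∧
        ((n : ℝ) • (1 : Matrix (Fin n) (Fin n) ℝ) - Q).det = 0} = 2 ^ (n - 1) := by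
  obtain ⟨m, rfl⟩ := Nat.exists_eq_add_of_le' hn
  exact ⟨by simpa using ncard_isSymm_sign_matrices (Fin (m + 1)),
    ncard_isSymm_sign_matrices_det_eq_zero m⟩
end

section
/- Let n ≥ 2 and let q ≥ 2 be even (so that −1 ∈ μ_q). Consider the set of complex Hermitian n × n matrices Q whose diagonal entries lie in {−1, +1} and whose strict upper-diagonal entries lie in the group μ_q of q-th roots of unity (so Q j i = conj(Q i j)); this set has cardinality 2^n · q^{n(n−1)/2}. The number of such Q having n as an eigenvalue is exactly q^{n−1}. Equivalently, if Q is chosen uniformly at random from this set, the probability that n is an eigenvalue of Q equals 2^{−n} · q^{−(n−1)(n−2)/2}. -/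
open Matrix

theorem eq_of_sum_eq_card_smul {E ι : Type*} [NormedAddCommGroup E] [InnerProductSpace ℝ E]
    [Fintype ι] {c : ι → E} {v : E} (hc : ∀ j, ‖c j‖ ≤ ‖v‖)
    (hsum : ∑ j, c j = Fintype.card ι • v) (j : ι) : c j = v := by
  have hle : ∀ k ∈ Finset.univ, inner ℝ (c k) v ≤ ‖v‖ ^ 2 := fun k _ =>
    (real_inner_le_norm _ _).trans <| by
      rw [sq]; exact mul_le_mul_of_nonneg_right (hc k) (norm_nonneg v)
  have heq : ∑ k, inner ℝ (c k) v = ∑ _k : ι, ‖v‖ ^ 2 := by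
    rw [← sum_inner, hsum, ← Nat.cast_smul_eq_nsmul ℝ, real_inner_smul_left,
      real_inner_self_eq_norm_sq]
    simp
  have hj := (Finset.sum_eq_sum_iff_of_le hle).1 heq j (Finset.mem_univ j)
  have hsq : ‖c j‖ ^ 2 ≤ ‖v‖ ^ 2 := pow_le_pow_left₀ (norm_nonneg _) (hc j) 2
  have hsub := norm_sub_sq_real (c j) v
  have hzero : ‖c j - v‖ ^ 2 = 0 := le_antisymm (by linarith) (sq_nonneg _)
  exact sub_eq_zero.1 (norm_eq_zero.1 (pow_eq_zero_iff two_ne_zero |>.1 hzero))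

/-- A matrix with entries of modulus at most one and eigenvalue equal to its size has rank one. -/
theorem exists_forall_mul_eq_of_det_card_smul_one_sub_eq_zero {ι : Type*} [Fintype ι]
    [DecidableEq ι] {Q : Matrix ι ι ℂ} (hQ : ∀ i j, ‖Q i j‖ ≤ 1)
    (hdet : ((Fintype.card ι : ℂ) • (1 : Matrix ι ι ℂ) - Q).det = 0) :
    ∃ v : ι → ℂ, (∀ i, v i ≠ 0) ∧ ∀ i j, Q i j * v j = v i := by
  obtain ⟨v, hv, hker⟩ := Matrix.exists_mulVec_eq_zero_iff.2 hdet
  have hrow : ∀ i, ∑ j, Q i j * v j = Fintype.card ι • v i := by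
    intro i
    have h := congrFun hker i
    rw [Matrix.sub_mulVec, Matrix.smul_mulVec, Matrix.one_mulVec] at h
    simp only [Pi.sub_apply, Pi.smul_apply, Pi.zero_apply, smul_eq_mul, sub_eq_zero] at h
    rw [nsmul_eq_mul, h]
    rfl
  obtain ⟨k, hk⟩ := Function.ne_iff.1 hv
  obtain ⟨m, -, hm⟩ := Finset.exists_max_image Finset.univ (fun i => ‖v i‖) ⟨k, Finset.mem_univ k⟩
  have hbound : ∀ i j, ‖Q i j * v j‖ ≤ ‖v j‖ := fun i j => by
    rw [norm_mul]; exact mul_le_of_le_one_left (norm_nonneg _) (hQ i j)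
  have hmax : ∀ j, Q m j * v j = v m := fun j =>
    eq_of_sum_eq_card_smul (fun l => (hbound m l).trans (hm l (Finset.mem_univ l))) (hrow m) j
  have hnorm : ∀ j, ‖v j‖ = ‖v m‖ := fun j =>
    le_antisymm (hm j (Finset.mem_univ j)) (by rw [← hmax j]; exact hbound m j)
  refine ⟨v, fun i hi => hk ?_, fun i => eq_of_sum_eq_card_smul (fun l => ?_) (hrow i)⟩
  · rw [Pi.zero_apply, ← norm_eq_zero, hnorm k, ← hnorm i, hi, norm_zero]
  · exact (hbound i l).trans (by rw [hnorm l, hnorm i])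

/-- The Hermitian matrix with prescribed diagonal and strict upper triangle. -/
noncomputable def hermitianOfUpper {n : ℕ} (d : Fin n → ℂ) (u : ∀ j : Fin n, {i // i < j} → ℂ) :
    Matrix (Fin n) (Fin n) ℂ :=
  fun i j => if h : i < j then u j ⟨i, h⟩ else if h : j < i then star (u i ⟨j, h⟩) else d i

theorem hermitianOfUpper_diag {n : ℕ} (d : Fin n → ℂ) (u : ∀ j : Fin n, {i // i < j} → ℂ)
    (i : Fin n) : hermitianOfUpper d u i i = d i := by
  simp [hermitianOfUpper]

theorem hermitianOfUpper_of_lt {n : ℕ} (d : Fin n → ℂ) (u : ∀ j : Fin n, {i // i < j} → ℂ)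
    {i j : Fin n} (h : i < j) : hermitianOfUpper d u i j = u j ⟨i, h⟩ := by
  simp [hermitianOfUpper, h]

theorem hermitianOfUpper_isHermitian {n : ℕ} {d : Fin n → ℂ} (hd : ∀ i, star (d i) = d i)
    (u : ∀ j : Fin n, {i // i < j} → ℂ) : (hermitianOfUpper d u).IsHermitian := by
  ext i j
  rw [Matrix.conjTranspose_apply]
  rcases lt_trichotomy i j with h | rfl | h
  · simp [hermitianOfUpper, h, h.not_gt]
  · rw [hermitianOfUpper_diag, hd]
  · simp [hermitianOfUpper, h, h.not_gt]

theorem hermitianOfUpper_eq {n : ℕ} {Q : Matrix (Fin n) (Fin n) ℂ} (hQ : Q.IsHermitian) :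
    hermitianOfUpper (fun i => Q i i) (fun j i => Q i j) = Q := by
  ext i j
  rcases lt_trichotomy i j with h | rfl | h
  · rw [hermitianOfUpper_of_lt _ _ h]
  · rw [hermitianOfUpper_diag]
  · simp [hermitianOfUpper, h, h.not_gt, hQ.apply i j]

theorem card_nthRootsFinset_complex {q : ℕ} (hq : q ≠ 0) :
    Fintype.card (Polynomial.nthRootsFinset q (1 : ℂ)) = q := by
  rw [Fintype.card_coe, (Complex.isPrimitiveRoot_exp q hq).card_nthRootsFinset]

theorem ncard_hermitian_roots_of_unity (n : ℕ) {q : ℕ} (hq : 0 < q) :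
    Set.ncard {Q : Matrix (Fin n) (Fin n) ℂ | Q.IsHermitian ∧
        (∀ i, Q i i = 1 ∨ Q i i = -1) ∧
        ∀ i j : Fin n, i < j → Q i j ^ q = 1} = 2 ^ n * q ^ (n * (n - 1) / 2) := by
  let F : (Fin n → ({1, -1} : Finset ℂ)) ×
      (∀ j : Fin n, {i // i < j} → Polynomial.nthRootsFinset q (1 : ℂ)) →
      Matrix (Fin n) (Fin n) ℂ :=
    fun p => hermitianOfUpper (fun i => p.1 i) (fun j i => p.2 j i)
  have hF : Function.Injective F := by
    intro p p' h
    refine Prod.ext (funext fun i => Subtype.ext ?_)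
      (funext fun j => funext fun i => Subtype.ext ?_)
    · have := congrFun (congrFun h i) i
      simpa only [F, hermitianOfUpper_diag] using this
    · have := congrFun (congrFun h i) j
      simpa only [F, hermitianOfUpper_of_lt _ _ i.2] using this
  have hrange : {Q : Matrix (Fin n) (Fin n) ℂ | Q.IsHermitian ∧
      (∀ i, Q i i = 1 ∨ Q i i = -1) ∧
      ∀ i j : Fin n, i < j → Q i j ^ q = 1} = Set.range F := by
    ext Q
    constructor
    · rintro ⟨hQ, hdiag, hup⟩
      exact ⟨(fun i => ⟨Q i i, by simpa using hdiag i⟩,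
        fun j i => ⟨Q i j, (Polynomial.mem_nthRootsFinset hq _).2 (hup i j i.2)⟩),
        hermitianOfUpper_eq hQ⟩
    · rintro ⟨p, rfl⟩
      have hd : ∀ i, (p.1 i : ℂ) = 1 ∨ (p.1 i : ℂ) = -1 := fun i => by
        simpa only [Finset.mem_insert, Finset.mem_singleton] using (p.1 i).2
      refine ⟨hermitianOfUpper_isHermitian (fun i => ?_) _, fun i => ?_, fun i j hij => ?_⟩
      · rcases hd i with h | h <;> simp [h]
      · simpa only [F, hermitianOfUpper_diag] using hd i
      · simp only [F, hermitianOfUpper_of_lt _ _ hij]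
        exact (Polynomial.mem_nthRootsFinset hq _).1 (p.2 j ⟨i, hij⟩).2
  have hcard : ∀ j : Fin n, Fintype.card {i // i < j} = j := fun j => by
    rw [Fintype.card_subtype, ← Fin.card_Iio j]
    congr 1
    ext i
    simp
  have hpair : ({1, -1} : Finset ℂ).card = 2 := Finset.card_pair (by norm_num)
  rw [hrange, Set.ncard, Set.encard, ENat.card_congr (Equiv.ofInjective F hF).symm,
    ENat.card_eq_coe_fintype_card, ENat.toNat_natCast]
  simp only [Fintype.card_prod, Fintype.card_pi, Finset.prod_const, Finset.card_univ,
    card_nthRootsFinset_complex hq.ne', hcard, Finset.prod_pow_eq_pow_sum, Fintype.card_fin,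
    Fin.sum_univ_eq_sum_range (fun i => i), Finset.sum_range_id, Fintype.card_coe, hpair]

/-- For `u` with unimodular entries, the matrix `star u i * u j` has eigenvalue its size. -/
theorem det_card_smul_one_sub_vecMulVec_star_eq_zero {ι : Type*} [Fintype ι] [DecidableEq ι]
    [Nonempty ι] {u : ι → ℂ} (hu : ∀ i, u i * star (u i) = 1) :
    ((Fintype.card ι : ℂ) • (1 : Matrix ι ι ℂ) - vecMulVec (star u) u).det = 0 := by
  refine Matrix.exists_mulVec_eq_zero_iff.1 ⟨star u, ?_, ?_⟩
  · obtain ⟨i⟩ := ‹Nonempty ι›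
    intro h
    have hi : star (u i) = 0 := congrFun h i
    simpa [hi] using hu i
  · have hdot : u ⬝ᵥ star u = (Fintype.card ι : ℂ) := by
      simp only [dotProduct, Pi.star_apply, hu]
      simp
    ext i
    rw [Matrix.sub_mulVec, Matrix.smul_mulVec, Matrix.one_mulVec, Matrix.vecMulVec_mulVec, hdot]
    simp [mul_comm]

theorem mul_star_eq_one_of_pow_eq_one {z : ℂ} {q : ℕ} (hq : q ≠ 0) (hz : z ^ q = 1) :
    z * star z = 1 := by
  rw [Complex.star_def, Complex.mul_conj, Complex.normSq_eq_norm_sq,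
    Complex.norm_eq_one_of_pow_eq_one hz hq]
  simp

theorem ncard_hermitian_roots_of_unity_eigenvalue_card (m : ℕ) {q : ℕ} (hq : 0 < q) :
    Set.ncard {Q : Matrix (Fin (m + 1)) (Fin (m + 1)) ℂ | (Q.IsHermitian ∧
        (∀ i, Q i i = 1 ∨ Q i i = -1) ∧
        ∀ i j : Fin (m + 1), i < j → Q i j ^ q = 1) ∧
        (((m + 1 : ℕ) : ℂ) • (1 : Matrix (Fin (m + 1)) (Fin (m + 1)) ℂ) - Q).det = 0} =
      q ^ m := by
  let w : (Fin m → Polynomial.nthRootsFinset q (1 : ℂ)) → Fin (m + 1) → ℂ :=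
    fun f => Fin.cons 1 fun i => (f i : ℂ)
  let F : (Fin m → Polynomial.nthRootsFinset q (1 : ℂ)) →
      Matrix (Fin (m + 1)) (Fin (m + 1)) ℂ := fun f => vecMulVec (star (w f)) (w f)
  have hw : ∀ f i, w f i ^ q = 1 := fun f i => by
    refine Fin.cases ?_ (fun k => ?_) i
    · simp [w]
    · exact (Polynomial.mem_nthRootsFinset hq _).1 (f k).2
  have hF : Function.Injective F := by
    intro f g h
    funext i
    have := congrFun (congrFun h 0) i.succ
    simp only [F, w, vecMulVec_apply, Pi.star_apply, Fin.cons_zero, Fin.cons_succ, star_one,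
      one_mul] at this
    exact Subtype.ext this
  have hrange : {Q : Matrix (Fin (m + 1)) (Fin (m + 1)) ℂ | (Q.IsHermitian ∧
        (∀ i, Q i i = 1 ∨ Q i i = -1) ∧
        ∀ i j : Fin (m + 1), i < j → Q i j ^ q = 1) ∧
        (((m + 1 : ℕ) : ℂ) • (1 : Matrix (Fin (m + 1)) (Fin (m + 1)) ℂ) - Q).det = 0} =
      Set.range F := by
    ext Q
    constructor
    · rintro ⟨⟨hQ, hdiag, hup⟩, hdet⟩
      have hnorm : ∀ i j, ‖Q i j‖ ≤ 1 := by
        intro i j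
        rcases lt_trichotomy i j with h | rfl | h
        · exact (Complex.norm_eq_one_of_pow_eq_one (hup i j h) hq.ne').le
        · rcases hdiag i with h | h <;> simp [h]
        · rw [← hQ.apply i j, norm_star]
          exact (Complex.norm_eq_one_of_pow_eq_one (hup j i h) hq.ne').le
      obtain ⟨v, hv, hmul⟩ := exists_forall_mul_eq_of_det_card_smul_one_sub_eq_zero hnorm
        (by rwa [Fintype.card_fin])
      have hQv : ∀ i j, Q i j = v i / v j := fun i j => (eq_div_iff (hv j)).2 (hmul i j)
      refine ⟨fun i => ⟨Q 0 i.succ,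
        (Polynomial.mem_nthRootsFinset hq _).2 (hup _ _ i.succ_pos)⟩, ?_⟩
      have hrow : ∀ i, w (fun i => ⟨Q 0 i.succ,
          (Polynomial.mem_nthRootsFinset hq _).2 (hup _ _ i.succ_pos)⟩) i = Q 0 i := fun i => by
        refine Fin.cases ?_ (fun k => ?_) i
        · simp [w, hQv, hv]
        · simp [w]
      ext i j
      simp only [F, vecMulVec_apply, Pi.star_apply, hrow]
      rw [hQ.apply i 0, hQv, hQv, hQv, div_mul_div_cancel₀ (hv 0)]
    · rintro ⟨f, rfl⟩
      have hone : ∀ i, w f i * star (w f i) = 1 := fun i =>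
        mul_star_eq_one_of_pow_eq_one hq.ne' (hw f i)
      refine ⟨⟨?_, fun i => Or.inl ?_, fun i j _ => ?_⟩, ?_⟩
      · ext i j
        simp [F, vecMulVec_apply, mul_comm]
      · rw [← hone i, mul_comm]
        rfl
      · simp only [F, vecMulVec_apply, Pi.star_apply, mul_pow, ← star_pow, hw, star_one, mul_one]
      · simpa only [Fintype.card_fin] using det_card_smul_one_sub_vecMulVec_star_eq_zero hone
  rw [hrange, Set.ncard, Set.encard, ENat.card_congr (Equiv.ofInjective F hF).symm,
    ENat.card_eq_coe_fintype_card, ENat.toNat_natCast]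
  simp only [Fintype.card_pi, Finset.prod_const, Finset.card_univ,
    card_nthRootsFinset_complex hq.ne', Fintype.card_fin]


/-- Let `q ≥ 2` be even. Among the `2 ^ n * q ^ (n*(n-1)/2)` complex Hermitian `n × n`
matrices `Q` with diagonal entries in `{-1, +1}` and strict upper-diagonal entries in the
group of `q`-th roots of unity, exactly `q ^ (n-1)` have `n` as an eigenvalue; hence the
probability of this event under the uniform measure is `2 ^ (-n) * q ^ (-(n-1)*(n-2)/2)`. -/
theorem count_eigenvalue_n_roots_of_unity
    (n q : ℕ) (hn : 2 ≤ n) (hq : 2 ≤ q) (hqeven : Even q) :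
    Set.ncard {Q : Matrix (Fin n) (Fin n) ℂ | Q.IsHermitian ∧
        (∀ i, Q i i = 1 ∨ Q i i = -1) ∧
        ∀ i j : Fin n, i < j → Q i j ^ q = 1} = 2 ^ n * q ^ (n * (n - 1) / 2) ∧
    Set.ncard {Q : Matrix (Fin n) (Fin n) ℂ | (Q.IsHermitian ∧
        (∀ i, Q i i = 1 ∨ Q i i = -1) ∧
        ∀ i j : Fin n, i < j → Q i j ^ q = 1) ∧
        ((n : ℂ) • (1 : Matrix (Fin n) (Fin n) ℂ) - Q).det = 0} = q ^ (n - 1) := by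
  refine ⟨ncard_hermitian_roots_of_unity n (by omega), ?_⟩
  obtain ⟨m, rfl⟩ : ∃ m, n = m + 1 := ⟨n - 1, by omega⟩
  exact ncard_hermitian_roots_of_unity_eigenvalue_card m (by omega)
end

section
/- Let n ≥ 1 and let M be an n × n real symmetric matrix with M i i = ∑_{j ≠ i} |M i j| for every i. Suppose M is not block-diagonal, i.e. for every subset S with ∅ ⊊ S ⊊ {1,…,n} there exist i ∈ S and j ∉ S with M i j ≠ 0. Then the kernel of M has dimension at most 1; equivalently, the rank of M is at least n − 1. -/
/-- If row `i` of `M` is weakly diagonally dominant, `M *ᵥ x` vanishes at `i`, and `|x i|` is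
maximal, then `|x|` takes the same value at every `j` with `M i j ≠ 0`. -/
theorem Matrix.abs_eq_of_mulVec_eq_zero_of_abs_le {ι : Type*} [Fintype ι] [DecidableEq ι]
    {M : Matrix ι ι ℝ} {x : ι → ℝ} {i : ι}
    (hdd : ∑ j ∈ Finset.univ.erase i, |M i j| ≤ |M i i|)
    (hx : (M.mulVec x) i = 0) (hmax : ∀ j, |x j| ≤ |x i|) {j : ι} (hij : M i j ≠ 0) :
    |x j| = |x i| := by
  obtain rfl | hne := eq_or_ne j i
  · rfl
  have hdiag : |M i i| * |x i| ≤ ∑ k ∈ Finset.univ.erase i, |M i k| * |x k| := by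
    have hrow : M i i * x i + ∑ k ∈ Finset.univ.erase i, M i k * x k = 0 := by
      rw [Finset.add_sum_erase _ (fun k => M i k * x k) (Finset.mem_univ i)]
      exact hx
    rw [← abs_mul, eq_neg_of_add_eq_zero_left hrow, abs_neg]
    simpa only [abs_mul] using
      Finset.abs_sum_le_sum_abs (fun k => M i k * x k) (Finset.univ.erase i)
  have hnonneg : ∀ k ∈ Finset.univ.erase i, 0 ≤ |M i k| * (|x i| - |x k|) := fun k _ =>
    mul_nonneg (abs_nonneg _) (sub_nonneg.2 (hmax k))
  have hsum : ∑ k ∈ Finset.univ.erase i, |M i k| * (|x i| - |x k|) = 0 := by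
    refine le_antisymm ?_ (Finset.sum_nonneg hnonneg)
    simp only [mul_sub, Finset.sum_sub_distrib, ← Finset.sum_mul]
    linarith [mul_le_mul_of_nonneg_right hdd (abs_nonneg (x i))]
  have hj := (Finset.sum_eq_zero_iff_of_nonneg hnonneg).1 hsum j (by simp [hne])
  have := (mul_eq_zero.1 hj).resolve_left (abs_ne_zero.2 hij)
  linarith

/-- A vector in the kernel of an irreducible weakly diagonally dominant real matrix has entries
of constant absolute value. -/
theorem Matrix.abs_eq_abs_of_mulVec_eq_zero {ι : Type*} [Fintype ι] [DecidableEq ι]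
    {M : Matrix ι ι ℝ} (hdd : ∀ i, ∑ j ∈ Finset.univ.erase i, |M i j| ≤ |M i i|)
    (hblock : ∀ S : Finset ι, S.Nonempty → S ≠ Finset.univ → ∃ i ∈ S, ∃ j ∉ S, M i j ≠ 0)
    {x : ι → ℝ} (hx : M.mulVec x = 0) (i j : ι) : |x i| = |x j| := by
  have : Nonempty ι := ⟨i⟩
  obtain ⟨m, hm⟩ := Finite.exists_max fun k => |x k|
  have huniv : Finset.univ.filter (fun k => |x k| = |x m|) = Finset.univ := by
    by_contra hne
    obtain ⟨k, hk, l, hl, hkl⟩ := hblock _ ⟨m, by simp⟩ hne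
    simp only [Finset.mem_filter, Finset.mem_univ, true_and] at hk hl
    exact hl ((abs_eq_of_mulVec_eq_zero_of_abs_le (hdd k) (congrFun hx k)
      (fun a => hk ▸ hm a) hkl).trans hk)
  have hconst : ∀ k, |x k| = |x m| := by simpa [Finset.filter_eq_self] using huniv
  rw [hconst i, hconst j]

/-- A real symmetric matrix whose every diagonal entry equals the sum of the absolute values
of the other entries of its row, and which is not block-diagonal, has kernel of dimension at
most `1`. -/
theorem laplacian_kernel_dim_le_one
    (n : ℕ) (hn : 1 ≤ n) (M : Matrix (Fin n) (Fin n) ℝ)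
    (hsym : M.IsSymm)
    (hdd : ∀ i, M i i = ∑ j ∈ Finset.univ.erase i, |M i j|)
    (hblock : ∀ S : Finset (Fin n), S.Nonempty → S ≠ Finset.univ →
      ∃ i ∈ S, ∃ j ∉ S, M i j ≠ 0) :
    Module.finrank ℝ (LinearMap.ker M.mulVecLin) ≤ 1 := by
  let i₀ : Fin n := ⟨0, hn⟩
  let f : LinearMap.ker M.mulVecLin →ₗ[ℝ] ℝ := LinearMap.proj i₀ ∘ₗ Submodule.subtype _
  have hf : Function.Injective f := by
    rw [injective_iff_map_eq_zero]
    rintro ⟨x, hx⟩ h0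
    have h0 : x i₀ = 0 := h0
    ext i
    have hi := Matrix.abs_eq_abs_of_mulVec_eq_zero
      (fun i => (hdd i).ge.trans (le_abs_self _)) hblock hx i i₀
    simpa [h0] using hi
  simpa using LinearMap.finrank_le_finrank_of_injective hf
end
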